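/- arXiv:2008.00896 — 12 statements merged into one kernel-verified Lean document; each statement's English description precedes it below -/
import Mathlib

section
/- Let y be a multilinear polynomial over ℝ in variables indexed by Fin n (every variable has degree at most 1), and let r and t be two distinct variable indices. For a, b ∈ {0, 1} let y_{ab} denote the polynomial obtained from y by substituting the variable r by the constant a and the variable t by the constant b (all other variables unchanged). Then y₀₀ · y₁₁ = y₀₁ · y₁₀ as polynomials if and only if there exist polynomials f and g with y = f · g such that the sets of variables occurring in f and in g are disjoint, t does not occur in f, and r does not occur in g. -/
/-- Substitute the variable `r` by the constant `a` and the variable `t` by the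
constant `b` in a multivariate polynomial, leaving all other variables unchanged. -/
noncomputable def substRT {n : ℕ} (r t : Fin n) (a b : ℝ)
    (y : MvPolynomial (Fin n) ℝ) : MvPolynomial (Fin n) ℝ :=
  MvPolynomial.aeval
    (fun i => if i = r then MvPolynomial.C a
      else if i = t then MvPolynomial.C b else MvPolynomial.X i) y

namespace MvPolynomial

theorem notMem_vars_of_dvd {σ R : Type*} [CommRing R] [IsDomain R] {p q : MvPolynomial σ R}
    {x : σ} (hpq : p ∣ q) (hq : q ≠ 0) (hx : x ∉ q.vars) : x ∉ p.vars := by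
  obtain ⟨s, rfl⟩ := hpq
  rw [mem_vars_iff_degreeOf_ne_zero, not_not] at hx ⊢
  rw [degreeOf_mul_eq (left_ne_zero_of_mul hq) (right_ne_zero_of_mul hq)] at hx
  omega

theorem disjoint_vars_of_degreeOf_mul_le_one {σ R : Type*} [CommRing R] [IsDomain R]
    {p q : MvPolynomial σ R} (hpq : p * q ≠ 0) (h : ∀ i, degreeOf i (p * q) ≤ 1) :
    Disjoint p.vars q.vars := by
  rw [Finset.disjoint_left]
  intro i hp hq
  rw [mem_vars_iff_degreeOf_ne_zero] at hp hq
  have hi := h i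
  rw [degreeOf_mul_eq (left_ne_zero_of_mul hpq) (right_ne_zero_of_mul hpq)] at hi
  omega

/-- Over a field, an equality of products `a * d = b * c` comes from a `2 × 2` array of factors,
which can be chosen to involve only variables occurring in `a`, `b`, `c` or `d`. -/
theorem exists_factors_of_mul_eq_mul {σ K : Type*} [Field K] {a b c d : MvPolynomial σ K}
    (h : a * d = b * c) :
    ∃ a₁ a₂ b₁ c₁ : MvPolynomial σ K,
      a = a₁ * a₂ ∧ b = a₁ * b₁ ∧ c = a₂ * c₁ ∧ d = b₁ * c₁ ∧
      ∀ x, x ∉ a.vars → x ∉ b.vars → x ∉ c.vars → x ∉ d.vars →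
        x ∉ a₁.vars ∧ x ∉ a₂.vars ∧ x ∉ b₁.vars ∧ x ∉ c₁.vars := by
  by_cases ha : a = 0
  · subst ha
    rw [zero_mul, eq_comm, mul_eq_zero] at h
    rcases h with rfl | rfl
    · exact ⟨0, c, d, 1, by simp, by simp, by simp, by simp, by simp_all⟩
    · exact ⟨b, 0, 1, d, by simp, by simp, by simp, by simp, by simp_all⟩
  · obtain ⟨a₁, a₂, ⟨b₁, rfl⟩, ⟨c₁, rfl⟩, rfl⟩ :=
      exists_dvd_and_dvd_of_dvd_mul (Dvd.intro d h)
    have ha₁ := left_ne_zero_of_mul ha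
    have ha₂ := right_ne_zero_of_mul ha
    have hfactor : ∀ {p q : MvPolynomial σ K} {x : σ}, p ≠ 0 → x ∉ (p * q).vars →
        x ∉ q.vars := by
      intro p q x hp hx
      by_cases hq : q = 0
      · simp [hq]
      · exact notMem_vars_of_dvd (dvd_mul_left q p) (mul_ne_zero hp hq) hx
    refine ⟨a₁, a₂, b₁, c₁, rfl, rfl, rfl, ?_, fun x hxa hxb hxc _ =>
      ⟨notMem_vars_of_dvd (dvd_mul_right _ _) ha hxa, hfactor ha₁ hxa, hfactor ha₁ hxb,
        hfactor ha₂ hxc⟩⟩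
    apply mul_left_cancel₀ ha
    rw [h]
    ring

theorem notMem_vars_add_mul_X {σ R : Type*} [CommSemiring R] [Nontrivial R]
    {p q : MvPolynomial σ R} {x z : σ} (hxz : x ≠ z)
    (hp : x ∉ p.vars) (hq : x ∉ q.vars) : x ∉ (p + q * X z).vars := by
  classical
  intro h
  rcases Finset.mem_union.1 (vars_add_subset _ _ h) with h | h
  · exact hp h
  · rcases Finset.mem_union.1 (vars_mul _ _ h) with h | h
    · exact hq h
    · rw [vars_X, Finset.mem_singleton] at h
      exact hxz h

end MvPolynomial

section substRT

open MvPolynomial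

variable {n : ℕ} {r t : Fin n}

theorem substRT_mul (a b : ℝ) (f g : MvPolynomial (Fin n) ℝ) :
    substRT r t a b (f * g) = substRT r t a b f * substRT r t a b g :=
  map_mul _ _ _

theorem substRT_congr_left {a b b' : ℝ} {f : MvPolynomial (Fin n) ℝ} (ht : t ∉ f.vars) :
    substRT r t a b f = substRT r t a b' f := by
  refine eval₂Hom_congr' rfl (fun i hi _ => ?_) rfl
  have hit : i ≠ t := fun h => ht (h ▸ hi)
  simp [hit]

theorem substRT_congr_right {a a' b : ℝ} {f : MvPolynomial (Fin n) ℝ} (hr : r ∉ f.vars) :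
    substRT r t a b f = substRT r t a' b f := by
  refine eval₂Hom_congr' rfl (fun i hi _ => ?_) rfl
  have hir : i ≠ r := fun h => hr (h ▸ hi)
  simp [hir]

theorem notMem_vars_substRT {a b : ℝ} (y : MvPolynomial (Fin n) ℝ) {x : Fin n}
    (hx : x = r ∨ x = t) : x ∉ (substRT r t a b y).vars := by
  intro h
  obtain ⟨i, -, hi⟩ := mem_vars_bind₁ _ _ h
  split_ifs at hi with h₁ h₂
  · simp at hi
  · simp at hi
  · rw [vars_X, Finset.mem_singleton] at hi
    subst hi
    tauto

theorem substRT_monomial (hrt : r ≠ t) (a b c : ℝ) (m : Fin n →₀ ℕ) :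
    substRT r t a b (monomial m c) =
      C c * (C a ^ m r * C b ^ m t * ∏ i ∈ (Finset.univ.erase r).erase t, X i ^ m i) := by
  have ht : t ∈ Finset.univ.erase r := by simp [hrt.symm]
  rw [substRT, aeval_monomial, Finsupp.prod_fintype _ _ (by simp),
    ← Finset.mul_prod_erase _ _ (Finset.mem_univ r), ← Finset.mul_prod_erase _ _ ht,
    Finset.prod_congr rfl (g := fun i => X i ^ m i)]
  · simp [hrt.symm, mul_assoc, algebraMap_eq]
  · intro i hi
    simp only [Finset.mem_erase] at hi
    simp [hi.1, hi.2.1]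

theorem monomial_eq_mul_prod_erase (hrt : r ≠ t) (c : ℝ) (m : Fin n →₀ ℕ) :
    monomial m c =
      C c * (X r ^ m r * X t ^ m t * ∏ i ∈ (Finset.univ.erase r).erase t, X i ^ m i) := by
  have ht : t ∈ Finset.univ.erase r := by simp [hrt.symm]
  rw [monomial_eq, Finsupp.prod_fintype _ _ (by simp),
    ← Finset.mul_prod_erase _ _ (Finset.mem_univ r), ← Finset.mul_prod_erase _ _ ht, mul_assoc]

theorem eq_substRT_expansion (hrt : r ≠ t) (y : MvPolynomial (Fin n) ℝ)
    (hr : degreeOf r y ≤ 1) (ht : degreeOf t y ≤ 1) :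
    y = substRT r t 0 0 y + (substRT r t 1 0 y - substRT r t 0 0 y) * X r +
      (substRT r t 0 1 y - substRT r t 0 0 y) * X t +
      (substRT r t 1 1 y - substRT r t 1 0 y - substRT r t 0 1 y + substRT r t 0 0 y) *
        (X r * X t) := by
  have hsum : ∀ a b : ℝ, substRT r t a b y =
      ∑ m ∈ y.support, substRT r t a b (monomial m (coeff m y)) := by
    intro a b
    conv_lhs => rw [y.as_sum]
    exact map_sum _ _ _
  simp only [hsum]
  conv_lhs => rw [y.as_sum]
  simp only [← Finset.sum_sub_distrib, ← Finset.sum_add_distrib, Finset.sum_mul]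
  refine Finset.sum_congr rfl fun m hm => ?_
  have hmr := (monomial_le_degreeOf r hm).trans hr
  have hmt := (monomial_le_degreeOf t hm).trans ht
  simp only [substRT_monomial hrt]
  rw [monomial_eq_mul_prod_erase hrt]
  generalize m r = k at hmr ⊢
  generalize m t = l at hmt ⊢
  interval_cases k <;> interval_cases l <;> simp <;> ring

end substRT

theorem stmt_1 (n : ℕ) (y : MvPolynomial (Fin n) ℝ)
    (hml : ∀ i : Fin n, MvPolynomial.degreeOf i y ≤ 1)
    (r t : Fin n) (hrt : r ≠ t) :
    substRT r t 0 0 y * substRT r t 1 1 y = substRT r t 0 1 y * substRT r t 1 0 y ↔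
      ∃ f g : MvPolynomial (Fin n) ℝ, y = f * g ∧
        Disjoint (MvPolynomial.vars f) (MvPolynomial.vars g) ∧
        t ∉ MvPolynomial.vars f ∧ r ∉ MvPolynomial.vars g := by
  constructor
  · intro h
    by_cases hy : y = 0
    · exact ⟨0, 0, by simp [hy], by simp, by simp, by simp⟩
    have hexp := eq_substRT_expansion hrt y (hml r) (hml t)
    obtain ⟨a₁, a₂, b₁, c₁, ha, hb, hc, hd, hvars⟩ :=
      MvPolynomial.exists_factors_of_mul_eq_mul
        (a := substRT r t 0 0 y) (b := substRT r t 1 0 y - substRT r t 0 0 y)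
        (c := substRT r t 0 1 y - substRT r t 0 0 y)
        (d := substRT r t 1 1 y - substRT r t 1 0 y - substRT r t 0 1 y + substRT r t 0 0 y)
        (by linear_combination h)
    have hsub : ∀ {p q : MvPolynomial (Fin n) ℝ} {x : Fin n}, x ∉ p.vars → x ∉ q.vars →
        x ∉ (p - q).vars := fun hp hq hpq =>
      (Finset.mem_union.1 (MvPolynomial.vars_sub_subset _ hpq)).elim hp hq
    have hadd : ∀ {p q : MvPolynomial (Fin n) ℝ} {x : Fin n}, x ∉ p.vars → x ∉ q.vars →
        x ∉ (p + q).vars := fun hp hq hpq =>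
      (Finset.mem_union.1 (MvPolynomial.vars_add_subset _ _ hpq)).elim hp hq
    have hfree : ∀ x, x = r ∨ x = t →
        x ∉ a₁.vars ∧ x ∉ a₂.vars ∧ x ∉ b₁.vars ∧ x ∉ c₁.vars := fun x hx => by
      have hs : ∀ a b : ℝ, x ∉ (substRT r t a b y).vars := fun _ _ => notMem_vars_substRT y hx
      exact hvars x (hs _ _) (hsub (hs _ _) (hs _ _)) (hsub (hs _ _) (hs _ _))
        (hadd (hsub (hsub (hs _ _) (hs _ _)) (hs _ _)) (hs _ _))
    have hfg : y = (a₂ + b₁ * MvPolynomial.X r) * (a₁ + c₁ * MvPolynomial.X t) := by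
      rw [hb, hc, hd, ha] at hexp
      rw [hexp]
      ring
    obtain ⟨-, ht₂, ht₃, -⟩ := hfree t (Or.inr rfl)
    obtain ⟨hr₁, -, -, hr₄⟩ := hfree r (Or.inl rfl)
    exact ⟨_, _, hfg,
      MvPolynomial.disjoint_vars_of_degreeOf_mul_le_one (hfg ▸ hy) (hfg ▸ hml),
      MvPolynomial.notMem_vars_add_mul_X hrt.symm ht₂ ht₃,
      MvPolynomial.notMem_vars_add_mul_X hrt hr₁ hr₄⟩
  · rintro ⟨f, g, rfl, -, ht, hr⟩
    simp only [substRT_mul]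
    rw [substRT_congr_left (a := 0) (b := 1) (b' := 0) ht,
      substRT_congr_left (a := 1) (b := 1) (b' := 0) ht,
      substRT_congr_right (a := 1) (a' := 0) (b := 0) hr,
      substRT_congr_right (a := 1) (a' := 0) (b := 1) hr]
    ring
end

section
/- Let g₁, …, g_N be multivariate real polynomials in h variables that form a linearly independent family. Let A be a subset of ℝ^h, let a be a point in the interior of A, and let H : ℝ^h → ℝ^h be a map that has an invertible strict Fréchet derivative at a (equivalently, H is strictly differentiable at a and the determinant of its Jacobian at a is nonzero). Define fᵢ : A → ℝ by fᵢ(z) = gᵢ(H(z)). Then the functions f₁, …, f_N are linearly independent: if c₁, …, c_N are real numbers with c₁·g₁(H(z)) + ⋯ + c_N·g_N(H(z)) = 0 for every z ∈ A, then c₁ = ⋯ = c_N = 0. -/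
/-- A real polynomial vanishing on a neighbourhood of a point is zero. -/
theorem MvPolynomial.eq_zero_of_eventually_eval_eq_zero {σ : Type*} [Fintype σ]
    {p : MvPolynomial σ ℝ} {b : σ → ℝ}
    (hp : ∀ᶠ x in nhds b, MvPolynomial.eval x p = 0) : p = 0 := by
  obtain ⟨ε, hε, hball⟩ := Metric.eventually_nhds_iff_ball.mp hp
  refine MvPolynomial.funext_set (fun i => Metric.ball (b i) ε)
    (fun i => infinite_of_mem_nhds (b i) (Metric.ball_mem_nhds _ hε)) fun x hx => ?_
  rw [map_zero]
  exact hball x (by rwa [ball_pi b hε])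

theorem stmt_5 (h N : ℕ) (g : Fin N → MvPolynomial (Fin h) ℝ)
    (hg : LinearIndependent ℝ g)
    (A : Set (Fin h → ℝ)) (a : Fin h → ℝ) (ha : a ∈ interior A)
    (H : (Fin h → ℝ) → (Fin h → ℝ))
    (L : (Fin h → ℝ) ≃L[ℝ] (Fin h → ℝ))
    (hH : HasStrictFDerivAt H (L : (Fin h → ℝ) →L[ℝ] (Fin h → ℝ)) a)
    (c : Fin N → ℝ)
    (hc : ∀ z ∈ A, ∑ i : Fin N, c i * MvPolynomial.eval (H z) (g i) = 0) :
    ∀ i, c i = 0 := by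
  have hp : ∑ i, c i • g i = 0 := by
    refine MvPolynomial.eq_zero_of_eventually_eval_eq_zero (b := H a) ?_
    rw [← hH.map_nhds_eq_of_equiv, Filter.eventually_map]
    filter_upwards [mem_interior_iff_mem_nhds.mp ha] with z hz
    simpa [MvPolynomial.smul_eval] using hc z hz
  exact Fintype.linearIndependent_iff.mp hg c hp
end

section
/- Let c₁, …, c_h be pairwise distinct real numbers, and let u₁, …, u_h be real numbers with pairwise distinct coordinates (uᵢ ≠ u_j for i ≠ j) such that uⱼ + cᵢ ≠ 0 for all i, j. Then the h × h real matrix J with entries J_{i,k} = ∏_{j ≠ k} (cᵢ + u_j) (the Jacobian matrix at u of the map H whose i-th component is H(z)ᵢ = ∏_{j=1}^{h} (cᵢ + z_j)) has nonzero determinant. -/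
open Polynomial in
theorem stmt_6 (h : ℕ) (c u : Fin h → ℝ)
    (hc : Function.Injective c) (hu : Function.Injective u)
    (hcu : ∀ i j, c i + u j ≠ 0)
    (J : Matrix (Fin h) (Fin h) ℝ)
    (hJ : ∀ i k, J i k = ∏ j ∈ Finset.univ.erase k, (c i + u j)) :
    J.det ≠ 0 := by
  intro hdet
  obtain ⟨v, hv, hJv⟩ := Matrix.exists_mulVec_eq_zero_iff.mpr hdet
  -- The kernel vector `v` gives a polynomial of degree less than `h` vanishing at every `c i`.
  let p : ℝ[X] := ∑ k, C (v k) * ∏ j ∈ Finset.univ.erase k, (X + C (u j))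
  have eval_p (x : ℝ) : p.eval x = ∑ k, v k * ∏ j ∈ Finset.univ.erase k, (x + u j) := by
    simp [p, eval_finsetSum, eval_prod]
  have hdeg : p.degree < (Finset.univ : Finset (Fin h)).card := by
    rw [← mem_degreeLT]
    refine Submodule.sum_mem _ fun k _ => ?_
    rw [← smul_eq_C_mul]
    refine Submodule.smul_mem _ _ ?_
    rw [mem_degreeLT, degree_prod]
    simp only [degree_X_add_C, Finset.sum_const, nsmul_eq_mul, mul_one]
    exact_mod_cast Finset.card_erase_lt_of_mem (Finset.mem_univ k)
  have hp : p = 0 := by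
    refine eq_zero_of_degree_lt_of_eval_index_eq_zero (v := c) Finset.univ hc.injOn hdeg ?_
    intro i _
    rw [eval_p]
    refine Eq.trans ?_ (congrFun hJv i)
    simp [Matrix.mulVec, dotProduct, hJ, mul_comm]
  refine hv (funext fun k => ?_)
  have hk := eval_p (-u k)
  rw [hp, eval_zero, Finset.sum_eq_single k] at hk
  · refine (mul_eq_zero.mp hk.symm).resolve_right (Finset.prod_ne_zero_iff.mpr fun j hj h0 => ?_)
    exact Finset.ne_of_mem_erase hj (hu (by linarith))
  · intro l _ hl
    rw [Finset.prod_eq_zero (i := k) (by simpa using hl.symm) (by simp), mul_zero]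
  · simp
end

section
/- Fix natural numbers h ≥ 1 and m, and let c₁, …, c_h be pairwise distinct real numbers. For each exponent tuple k = (k₁, …, k_h) with every kᵢ ∈ {0, …, m}, define the polynomial f_k(z₁, …, z_h) = ∏_{i=1}^{h} ∏_{j=1}^{h} (cᵢ + z_j)^{kᵢ}. Then the family of polynomials (f_k), indexed by all (m+1)^h such exponent tuples, is linearly independent over ℝ. -/
open MvPolynomial in
/-- Monomials of bounded degree in each variable, evaluated at an algebraically independent
family, are linearly independent. -/
lemma AlgebraicIndependent.linearIndependent_prod_pow {ι R A : Type*} [Fintype ι] [CommRing R]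
    [CommRing A] [Algebra R A] {x : ι → A} (hx : AlgebraicIndependent R x) (n : ℕ) :
    LinearIndependent R (fun k : ι → Fin n => ∏ i, x i ^ (k i : ℕ)) := by
  have hinj : Function.Injective
      (fun k : ι → Fin n => Finsupp.equivFunOnFinite.symm fun i => (k i : ℕ)) := by
    intro k l hkl
    ext i
    exact DFunLike.congr_fun hkl i
  have hmap := ((basisMonomials ι R).linearIndependent.comp _ hinj).map'
    (aeval x : MvPolynomial ι R →ₐ[R] A).toLinearMap (LinearMap.ker_eq_bot.2 hx)
  have heq : (fun k : ι → Fin n => ∏ i, x i ^ (k i : ℕ)) =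
      (aeval x : MvPolynomial ι R →ₐ[R] A).toLinearMap ∘ basisMonomials ι R ∘
        fun k => Finsupp.equivFunOnFinite.symm fun i => (k i : ℕ) := by
    funext k
    simp [aeval_monomial, Finsupp.prod_fintype]
  rw [heq]
  exact hmap

open MvPolynomial in
/-- An invertible affine change of an algebraically independent family is algebraically
independent. -/
lemma AlgebraicIndependent.affine {ι κ R A : Type*} [Fintype ι] [Fintype κ] [DecidableEq κ]
    [CommRing R] [CommRing A] [Algebra R A] {x : ι → A} (hx : AlgebraicIndependent R x)
    (b : κ → R) (M : Matrix κ ι R) (N : Matrix ι κ R) (hMN : M * N = 1) :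
    AlgebraicIndependent R (fun i => algebraMap R A (b i) + ∑ r, algebraMap R A (M i r) * x r) := by
  let L : κ → MvPolynomial ι R := fun i => C (b i) + ∑ r, C (M i r) * X r
  let inv : MvPolynomial ι R →ₐ[R] MvPolynomial κ R :=
    aeval fun r => ∑ j, C (N r j) * (X j - C (b j))
  have hinv : inv.comp (aeval L) = AlgHom.id R _ := by
    ext1 i
    have hsum : ∑ r, C (M i r) * ∑ j, C (N r j) * (X j - C (b j)) =
        (X i - C (b i) : MvPolynomial κ R) := by
      calc _ = ∑ j, C ((M * N) i j) * (X j - C (b j)) := by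
            simp only [Matrix.mul_apply, map_sum, map_mul, Finset.sum_mul, Finset.mul_sum]
            rw [Finset.sum_comm]
            simp only [mul_assoc]
        _ = _ := by simp [hMN, Matrix.one_apply, apply_ite C, ite_mul]
    simp only [L, inv, AlgHom.comp_apply, aeval_X, map_add, map_sum, map_mul, AlgHom.id_apply,
      aeval_C, algebraMap_eq, hsum]
    ring
  have hL : Function.Injective (aeval L : MvPolynomial κ R →ₐ[R] MvPolynomial ι R) :=
    Function.LeftInverse.injective (g := inv) fun p => DFunLike.congr_fun hinv p
  have hcomp : (aeval fun i => algebraMap R A (b i) + ∑ r, algebraMap R A (M i r) * x r :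
      MvPolynomial κ R →ₐ[R] A) = (aeval x).comp (aeval L) := by
    ext i
    simp [L]
  rw [AlgebraicIndependent, hcomp, AlgHom.coe_comp]
  exact Function.Injective.comp (g := aeval x) hx hL

open MvPolynomial in
lemma MvPolynomial.algebraicIndependent_esymm (R : Type*) [CommRing R] (n : ℕ) :
    AlgebraicIndependent R (fun i : Fin n => esymm (Fin n) R (i + 1)) := by
  intro p q hpq
  refine esymmAlgHom_injective (σ := Fin n) (R := R) (n := n) (by simp) (Subtype.ext ?_)
  simpa only [esymmAlgHom_apply] using hpq

open MvPolynomial in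
lemma MvPolynomial.prod_C_add_X_fin {R : Type*} [CommRing R] (n : ℕ) (a : R) :
    ∏ j : Fin n, (C a + X j : MvPolynomial (Fin n) R) =
      C (a ^ n) + ∑ r : Fin n, C (a ^ (r.rev : ℕ)) * esymm (Fin n) R (r + 1) := by
  have key := congrArg (Polynomial.eval (C a)) (prod_C_add_X_eq_sum_esymm R (Fin n))
  simp only [Polynomial.eval_prod, Polynomial.eval_finsetSum, Polynomial.eval_add,
    Polynomial.eval_mul, Polynomial.eval_pow, Polynomial.eval_X, Polynomial.eval_C,
    Fintype.card_fin] at key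
  rw [key, Finset.sum_range_succ', Finset.sum_range, add_comm]
  simp [Fin.val_rev, mul_comm]

theorem stmt_7 (h m : ℕ) (hh : 1 ≤ h) (c : Fin h → ℝ) (hc : Function.Injective c) :
    LinearIndependent ℝ (fun (k : Fin h → Fin (m + 1)) =>
      ∏ i : Fin h,
        (∏ j : Fin h, (MvPolynomial.C (c i) + MvPolynomial.X j :
          MvPolynomial (Fin h) ℝ)) ^ (k i : ℕ)) := by
  have hdet : IsUnit (Matrix.vandermonde c).det :=
    (Matrix.det_vandermonde_ne_zero_iff.2 hc).isUnit
  have hMN : (Matrix.vandermonde c).submatrix id Fin.revPerm *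
      (Matrix.vandermonde c)⁻¹.submatrix Fin.revPerm id = 1 := by
    rw [Matrix.submatrix_mul_equiv, Matrix.mul_nonsing_inv _ hdet, Matrix.submatrix_id_id]
  have hind := (MvPolynomial.algebraicIndependent_esymm ℝ h).affine (fun i => c i ^ h) _ _ hMN
  simp only [MvPolynomial.prod_C_add_X_fin]
  exact hind.linearIndependent_prod_pow (m + 1)
end

section
/- Let c ∈ (0,1) and let z₀₀, z₀₁, z₁₀, z₁₁ be real numbers with 0 < z₀₀ < z₀₁ = z₁₀ < z₁₁ and z₀₀·z₁₁ − z₀₁·z₁₀ ≠ 0. Let B be the 2 × 2 real matrix with first row ((1−c)·z₀₀, c·z₀₁) and second row ((1−c)·z₁₀, c·z₁₁). Then B has two real eigenvalues λ₁ and λ₂, i.e. there exist real numbers λ₁, λ₂ with λ₁ + λ₂ = (1−c)·z₀₀ + c·z₁₁ (the trace of B) and λ₁·λ₂ = c·(1−c)·(z₀₀·z₁₁ − z₀₁·z₁₀) (the determinant of B), and these satisfy λ₁ ≠ 0, λ₂ ≠ 0, λ₁ ≠ λ₂, and λ₁ ≠ −λ₂. -/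
theorem stmt_9 (c : ℝ) (hc : c ∈ Set.Ioo (0 : ℝ) 1)
    (z00 z01 z10 z11 : ℝ) (h0 : 0 < z00) (h1 : z00 < z01) (heq : z01 = z10)
    (h2 : z10 < z11) (hdet : z00 * z11 - z01 * z10 ≠ 0)
    (B : Matrix (Fin 2) (Fin 2) ℝ)
    (hB : B = !![(1 - c) * z00, c * z01; (1 - c) * z10, c * z11]) :
    ∃ lam₁ lam₂ : ℝ,
      lam₁ + lam₂ = (1 - c) * z00 + c * z11 ∧
      lam₁ * lam₂ = c * (1 - c) * (z00 * z11 - z01 * z10) ∧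
      lam₁ ≠ 0 ∧ lam₂ ≠ 0 ∧ lam₁ ≠ lam₂ ∧ lam₁ ≠ -lam₂ := by
  obtain ⟨hc0, hc1⟩ := hc
  subst heq
  have hc1' : 0 < 1 - c := sub_pos.mpr hc1
  have hz01 : 0 < z01 := h0.trans h1
  have hz11 : 0 < z11 := hz01.trans h2
  have htrace : 0 < (1 - c) * z00 + c * z11 := by positivity
  have hprod : c * (1 - c) * (z00 * z11 - z01 * z01) ≠ 0 :=
    mul_ne_zero (mul_pos hc0 hc1').ne' hdet
  have hdisc : 0 < ((1 - c) * z00 - c * z11) ^ 2 + 4 * (c * (1 - c) * (z01 * z01)) := by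
    positivity
  obtain ⟨s, hs, hsq⟩ : ∃ s : ℝ, 0 < s ∧
      s ^ 2 = ((1 - c) * z00 - c * z11) ^ 2 + 4 * (c * (1 - c) * (z01 * z01)) :=
    ⟨_, Real.sqrt_pos.mpr hdisc, Real.sq_sqrt hdisc.le⟩
  have hmul : ((1 - c) * z00 + c * z11 + s) / 2 * (((1 - c) * z00 + c * z11 - s) / 2) =
      c * (1 - c) * (z00 * z11 - z01 * z01) := by
    linear_combination -hsq / 4
  have hne := hmul.trans_ne hprod
  refine ⟨_, _, by ring, hmul, left_ne_zero_of_mul hne, right_ne_zero_of_mul hne, ?_, ?_⟩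
  · intro h
    linarith
  · intro h
    linarith
end

section
/- Let f₀₀, f₀₁, f₁₀, f₁₁ be four multivariate real polynomials (in n variables) such that f₀₀·f₁₁ = f₀₁·f₁₀ as polynomials, i.e. the determinant of the 2 × 2 matrix of polynomials [[f₀₀, f₀₁],[f₁₀, f₁₁]] is identically zero. Then there exist polynomials g₀, g₁, h₀, h₁ such that f_{ij} = g_i·h_j for all i, j ∈ {0, 1}; that is, the matrix factors as the outer product of the column vector (g₀, g₁) with the row vector (h₀, h₁). -/
/-- Over a cancellative commutative monoid with zero in which every element is primal, a `2 × 2`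
matrix with vanishing determinant is an outer product of a column and a row. -/
theorem exists_outer_product_of_mul_eq_mul {R : Type*} [CommMonoidWithZero R]
    [IsCancelMulZero R] [DecompositionMonoid R] {a b c d : R} (h : a * d = b * c) :
    ∃ g₀ g₁ h₀ h₁ : R, a = g₀ * h₀ ∧ b = g₀ * h₁ ∧ c = g₁ * h₀ ∧ d = g₁ * h₁ := by
  by_cases ha : a = 0
  · subst ha
    rw [zero_mul, eq_comm, mul_eq_zero] at h
    rcases h with rfl | rfl
    · exact ⟨0, 1, c, d, by simp⟩
    · exact ⟨b, d, 0, 1, by simp⟩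
  · obtain ⟨x, y, ⟨s, rfl⟩, ⟨t, rfl⟩, rfl⟩ := exists_dvd_and_dvd_of_dvd_mul (Dvd.intro d h)
    refine ⟨x, t, y, s, rfl, rfl, mul_comm y t, mul_left_cancel₀ ha ?_⟩
    rw [h, mul_mul_mul_comm, mul_comm s t]

theorem stmt_11 (n : ℕ) (f00 f01 f10 f11 : MvPolynomial (Fin n) ℝ)
    (hdet : f00 * f11 = f01 * f10) :
    ∃ g0 g1 h0 h1 : MvPolynomial (Fin n) ℝ,
      f00 = g0 * h0 ∧ f01 = g0 * h1 ∧ f10 = g1 * h0 ∧ f11 = g1 * h1 :=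
  exists_outer_product_of_mul_eq_mul hdet
end

section
/- Let F, G, H, K be monotone Boolean functions on n variables with multilinear extensions f, g, h, k respectively. If F ∧ G and H ∧ K are not equal as Boolean functions (i.e. there is an assignment θ : Fin n → Bool with (F θ ∧ G θ) ≠ (H θ ∧ K θ)), then there exists φ : Fin n → ℝ with φ i ∈ {1/2, 1} for every i such that f(φ)·g(φ) ≠ h(φ)·k(φ). -/
/-- The multilinear extension (arithmetization) of a Boolean function on `n` variables. -/
noncomputable def mlext {n : ℕ} (F : (Fin n → Bool) → Bool) (x : Fin n → ℝ) : ℝ :=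
  ∑ θ : Fin n → Bool, (if F θ then (1 : ℝ) else 0) *
    ∏ i : Fin n, (if θ i then x i else 1 - x i)

theorem sum_prod_ite_eq_one {n : ℕ} (x : Fin n → ℝ) :
    ∑ θ : Fin n → Bool, ∏ i : Fin n, (if θ i then x i else 1 - x i) = 1 := by
  have h := Fintype.prod_sum (fun (i : Fin n) (b : Bool) => if b then x i else 1 - x i)
  simpa using h.symm

theorem prod_ite_nonneg {n : ℕ} {x : Fin n → ℝ} (h0 : ∀ i, 0 ≤ x i) (h1 : ∀ i, x i ≤ 1)
    (θ : Fin n → Bool) : 0 ≤ ∏ i : Fin n, (if θ i then x i else 1 - x i) := by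
  refine Finset.prod_nonneg fun i _ => ?_
  split_ifs
  · exact h0 i
  · exact sub_nonneg.2 (h1 i)

theorem mlext_nonneg {n : ℕ} (F : (Fin n → Bool) → Bool) {x : Fin n → ℝ}
    (h0 : ∀ i, 0 ≤ x i) (h1 : ∀ i, x i ≤ 1) : 0 ≤ mlext F x := by
  refine Finset.sum_nonneg fun θ _ => mul_nonneg ?_ (prod_ite_nonneg h0 h1 θ)
  split_ifs <;> norm_num

theorem mlext_le_one {n : ℕ} (F : (Fin n → Bool) → Bool) {x : Fin n → ℝ}
    (h0 : ∀ i, 0 ≤ x i) (h1 : ∀ i, x i ≤ 1) : mlext F x ≤ 1 := by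
  rw [← sum_prod_ite_eq_one x]
  refine Finset.sum_le_sum fun θ _ => mul_le_of_le_one_left (prod_ite_nonneg h0 h1 θ) ?_
  split_ifs <;> norm_num

theorem mlext_lt_one {n : ℕ} {F : (Fin n → Bool) → Bool} {x : Fin n → ℝ}
    (h0 : ∀ i, 0 ≤ x i) (h1 : ∀ i, x i ≤ 1) {θ : Fin n → Bool} (hθ : F θ = false)
    (hpos : 0 < ∏ i : Fin n, (if θ i then x i else 1 - x i)) : mlext F x < 1 := by
  rw [← sum_prod_ite_eq_one x]
  refine Finset.sum_lt_sum
    (fun η _ => mul_le_of_le_one_left (prod_ite_nonneg h0 h1 η) ?_) ⟨θ, Finset.mem_univ θ, ?_⟩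
  · split_ifs <;> norm_num
  · simpa [hθ] using hpos

theorem mlext_eq_one {n : ℕ} {F : (Fin n → Bool) → Bool} (hF : Monotone F)
    {θ : Fin n → Bool} (hθ : F θ = true) {x : Fin n → ℝ} (hx : ∀ i, θ i = true → x i = 1) :
    mlext F x = 1 := by
  rw [← sum_prod_ite_eq_one x]
  refine Finset.sum_congr rfl fun η _ => ?_
  by_cases hle : θ ≤ η
  · have hη : F η = true := hF hle hθ
    simp [hη]
  · obtain ⟨i, hi⟩ := not_forall.1 hle
    have hi' : θ i = true ∧ η i = false := by
      simpa [Bool.le_iff_imp] using hi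
    rw [Finset.prod_eq_zero (Finset.mem_univ i) (by simp [hi'.2, hx i hi'.1]), mul_zero]

/-- The point equal to `1` where `θ` is true and to `1 / 2` elsewhere. -/
noncomputable def halfPoint {n : ℕ} (θ : Fin n → Bool) (i : Fin n) : ℝ :=
  if θ i then 1 else 1 / 2

theorem mlext_halfPoint_mul_ne {n : ℕ} {F G H K : (Fin n → Bool) → Bool}
    (hF : Monotone F) (hG : Monotone G) {θ : Fin n → Bool}
    (hFG : (F θ && G θ) = true) (hHK : (H θ && K θ) = false) :
    mlext F (halfPoint θ) * mlext G (halfPoint θ) ≠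
      mlext H (halfPoint θ) * mlext K (halfPoint θ) := by
  have h0 : ∀ i, 0 ≤ halfPoint θ i := fun i => by unfold halfPoint; split_ifs <;> norm_num
  have h1 : ∀ i, halfPoint θ i ≤ 1 := fun i => by unfold halfPoint; split_ifs <;> norm_num
  have hx : ∀ i, θ i = true → halfPoint θ i = 1 := fun i hi => by simp [halfPoint, hi]
  have hpos : 0 < ∏ i : Fin n, (if θ i then halfPoint θ i else 1 - halfPoint θ i) := by
    refine Finset.prod_pos fun i _ => ?_
    cases hi : θ i <;> norm_num [halfPoint, hi]
  obtain ⟨hFθ, hGθ⟩ := (Bool.and_eq_true_iff).1 hFG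
  rw [mlext_eq_one hF hFθ hx, mlext_eq_one hG hGθ hx, one_mul]
  refine ne_of_gt ?_
  rcases (Bool.and_eq_false_iff).1 hHK with h | h
  · exact mul_lt_one_of_nonneg_of_lt_one_left (mlext_nonneg H h0 h1)
      (mlext_lt_one h0 h1 h hpos) (mlext_le_one K h0 h1)
  · exact mul_lt_one_of_nonneg_of_lt_one_right (mlext_le_one H h0 h1)
      (mlext_nonneg K h0 h1) (mlext_lt_one h0 h1 h hpos)

theorem stmt_12 (n : ℕ) (F G H K : (Fin n → Bool) → Bool)
    (hF : Monotone F) (hG : Monotone G) (hH : Monotone H) (hK : Monotone K)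
    (hne : ∃ θ : Fin n → Bool, (F θ && G θ) ≠ (H θ && K θ)) :
    ∃ φ : Fin n → ℝ, (∀ i, φ i ∈ ({1 / 2, 1} : Set ℝ)) ∧
      mlext F φ * mlext G φ ≠ mlext H φ * mlext K φ := by
  obtain ⟨θ, hθ⟩ := hne
  refine ⟨halfPoint θ, fun i => ?_, ?_⟩
  · unfold halfPoint
    split_ifs <;> simp
  · cases hFG : (F θ && G θ) <;> cases hHK : (H θ && K θ)
    · simp [hFG, hHK] at hθ
    · exact (mlext_halfPoint_mul_ne hH hK hHK hFG).symm
    · exact mlext_halfPoint_mul_ne hF hG hFG hHK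
    · simp [hFG, hHK] at hθ
end

section
/- Let Ω be a finite probability space and let U : Ω → α, V : Ω → β, X : Ω → γ be random variables and Y : Ω → Bool a binary random variable. If (i) U and V are conditionally independent given X, and (ii) the pair (U, X) is conditionally independent of V given Y, then either V is independent of Y, or U is conditionally independent of Y given X. -/
open Classical in
/-- The probability of an event `E` with respect to a weight function `w` on a
finite sample space. -/
noncomputable def prOf {Ω : Type*} [Fintype Ω] (w : Ω → ℝ) (E : Ω → Prop) : ℝ :=
  ∑ ω : Ω, if E ω then w ω else 0

open Classical in
/-- Law of total probability, over the finitely many values taken by `f`. -/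
theorem prOf_eq_sum_image {Ω α : Type*} [Fintype Ω] (w : Ω → ℝ) (f : Ω → α) (E : Ω → Prop) :
    prOf w E = ∑ a ∈ Finset.univ.image f, prOf w (fun ω => f ω = a ∧ E ω) := by
  unfold prOf
  rw [Finset.sum_comm]
  refine Finset.sum_congr rfl fun ω _ => ?_
  by_cases h : E ω <;> simp [h]

/-- Law of total probability for a binary random variable. -/
theorem prOf_eq_add_bool {Ω : Type*} [Fintype Ω] (w : Ω → ℝ) (Y : Ω → Bool) (E : Ω → Prop) :
    prOf w E = prOf w (fun ω => E ω ∧ Y ω = true) + prOf w (fun ω => E ω ∧ Y ω = false) := by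
  unfold prOf
  rw [← Finset.sum_add_distrib]
  refine Finset.sum_congr rfl fun ω _ => ?_
  by_cases h : E ω <;> cases hY : Y ω <;> simp [h, hY]

theorem prOf_true {Ω : Type*} [Fintype Ω] (w : Ω → ℝ) :
    prOf w (fun _ => True) = ∑ ω, w ω := by
  simp [prOf]

theorem prOf_nonneg {Ω : Type*} [Fintype Ω] {w : Ω → ℝ} (hw : ∀ ω, 0 ≤ w ω) (E : Ω → Prop) :
    0 ≤ prOf w E :=
  Finset.sum_nonneg fun ω _ => by split_ifs <;> simp [hw ω]

theorem prOf_mono {Ω : Type*} [Fintype Ω] {w : Ω → ℝ} (hw : ∀ ω, 0 ≤ w ω) {E F : Ω → Prop}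
    (h : ∀ ω, E ω → F ω) : prOf w E ≤ prOf w F := by
  refine Finset.sum_le_sum fun ω _ => ?_
  by_cases hE : E ω
  · simp [hE, h ω hE]
  · rw [if_neg hE]
    split_ifs <;> simp [hw ω]

/-- In a mixture of two components of weights `p` and `q`, let `t` and `z` be the masses obtained
from `r` and `s` by intersecting with an event of masses `v` that is independent of them within
each component. If this intersection preserves the ratio of the total masses of `r` and `s`, then
either `v / p` is the same for both components, or `r / s` is. -/
theorem mul_eq_mul_or_mul_eq_mul_of_mixture {p q r₁ r₀ s₁ s₀ v₁ v₀ t₁ t₀ z₁ z₀ : ℝ}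
    (hp : p ≠ 0) (hq : q ≠ 0) (ht₁ : t₁ * p = r₁ * v₁) (ht₀ : t₀ * q = r₀ * v₀)
    (hz₁ : z₁ * p = s₁ * v₁) (hz₀ : z₀ * q = s₀ * v₀)
    (h : (t₁ + t₀) * (s₁ + s₀) = (r₁ + r₀) * (z₁ + z₀)) :
    v₁ * q = v₀ * p ∨ r₁ * s₀ = r₀ * s₁ := by
  rw [← eq_div_iff hp] at ht₁ hz₁
  rw [← eq_div_iff hq] at ht₀ hz₀
  subst ht₁ ht₀ hz₁ hz₀
  have key : (v₁ * q - v₀ * p) * (r₁ * s₀ - r₀ * s₁) = 0 := by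
    field_simp at h
    linear_combination h
  exact (mul_eq_zero.mp key).imp sub_eq_zero.mp sub_eq_zero.mp

theorem stmt_15 {Ω α β γ : Type*} [Fintype Ω]
    (w : Ω → ℝ) (hw : ∀ ω, 0 ≤ w ω) (hsum : ∑ ω : Ω, w ω = 1)
    (U : Ω → α) (V : Ω → β) (X : Ω → γ) (Y : Ω → Bool)
    -- (i) U and V are conditionally independent given X
    (hUVX : ∀ (a : α) (b : β) (x : γ),
      prOf w (fun ω => U ω = a ∧ V ω = b ∧ X ω = x) * prOf w (fun ω => X ω = x) =
      prOf w (fun ω => U ω = a ∧ X ω = x) * prOf w (fun ω => V ω = b ∧ X ω = x))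
    -- (ii) the pair (U, X) is conditionally independent of V given Y
    (hUXVY : ∀ (a : α) (x : γ) (b : β) (y : Bool),
      prOf w (fun ω => (U ω = a ∧ X ω = x) ∧ V ω = b ∧ Y ω = y) *
        prOf w (fun ω => Y ω = y) =
      prOf w (fun ω => (U ω = a ∧ X ω = x) ∧ Y ω = y) *
        prOf w (fun ω => V ω = b ∧ Y ω = y)) :
    -- either V is independent of Y, or U is conditionally independent of Y given X
    (∀ (b : β) (y : Bool),
      prOf w (fun ω => V ω = b ∧ Y ω = y) =
        prOf w (fun ω => V ω = b) * prOf w (fun ω => Y ω = y)) ∨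
    (∀ (a : α) (y : Bool) (x : γ),
      prOf w (fun ω => U ω = a ∧ Y ω = y ∧ X ω = x) * prOf w (fun ω => X ω = x) =
      prOf w (fun ω => U ω = a ∧ X ω = x) * prOf w (fun ω => Y ω = y ∧ X ω = x)) := by
  set p := prOf w (fun ω => Y ω = true) with hp_def
  set q := prOf w (fun ω => Y ω = false) with hq_def
  have hpq : p + q = 1 := by
    have h := prOf_eq_add_bool w Y (fun _ => True)
    simp only [true_and, prOf_true, hsum] at h
    exact h.symm
  have hV (b : β) := prOf_eq_add_bool w Y (fun ω => V ω = b)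
  have indep_of_eq (h : ∀ b, prOf w (fun ω => V ω = b ∧ Y ω = true) * q =
      prOf w (fun ω => V ω = b ∧ Y ω = false) * p) (b : β) (y : Bool) :
      prOf w (fun ω => V ω = b ∧ Y ω = y) =
        prOf w (fun ω => V ω = b) * prOf w (fun ω => Y ω = y) := by
    rw [hV b]
    cases y
    · rw [← hq_def]
      linear_combination (-prOf w (fun ω => V ω = b ∧ Y ω = false)) * hpq - h b
    · rw [← hp_def]
      linear_combination (-prOf w (fun ω => V ω = b ∧ Y ω = true)) * hpq + h b
  have hle (b : β) (y : Bool) :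
      prOf w (fun ω => V ω = b ∧ Y ω = y) ≤ prOf w (fun ω => Y ω = y) :=
    prOf_mono hw fun _ h => h.2
  by_cases hp : p = 0
  · refine Or.inl (indep_of_eq fun b => ?_)
    rw [hp, le_antisymm ((hle b true).trans_eq hp) (prOf_nonneg hw _)]
    ring
  by_cases hq : q = 0
  · refine Or.inl (indep_of_eq fun b => ?_)
    rw [hq, le_antisymm ((hle b false).trans_eq hq) (prOf_nonneg hw _)]
    ring
  have hXVY (x : γ) (b : β) (y : Bool) :
      prOf w (fun ω => (V ω = b ∧ X ω = x) ∧ Y ω = y) * prOf w (fun ω => Y ω = y) =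
      prOf w (fun ω => X ω = x ∧ Y ω = y) * prOf w (fun ω => V ω = b ∧ Y ω = y) := by
    rw [prOf_eq_sum_image w U (fun ω => (V ω = b ∧ X ω = x) ∧ Y ω = y),
      prOf_eq_sum_image w U (fun ω => X ω = x ∧ Y ω = y), Finset.sum_mul, Finset.sum_mul]
    refine Finset.sum_congr rfl fun a _ => ?_
    convert hUXVY a x b y using 3 <;> (ext ω; tauto)
  have hUVXY (a : α) (x : γ) (b : β) (y : Bool) :
      prOf w (fun ω => (U ω = a ∧ V ω = b ∧ X ω = x) ∧ Y ω = y) * prOf w (fun ω => Y ω = y) =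
      prOf w (fun ω => (U ω = a ∧ X ω = x) ∧ Y ω = y) *
        prOf w (fun ω => V ω = b ∧ Y ω = y) := by
    convert hUXVY a x b y using 3
    ext ω
    tauto
  refine or_iff_not_imp_left.mpr fun hVY a y x => ?_
  obtain ⟨b, hb⟩ := not_forall.mp (mt indep_of_eq hVY)
  have hUX := prOf_eq_add_bool w Y (fun ω => U ω = a ∧ X ω = x)
  have hX := prOf_eq_add_bool w Y (fun ω => X ω = x)
  have hmix := hUVX a b x
  rw [prOf_eq_add_bool w Y (fun ω => U ω = a ∧ V ω = b ∧ X ω = x), hX, hUX,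
    prOf_eq_add_bool w Y (fun ω => V ω = b ∧ X ω = x)] at hmix
  have hrs := (mul_eq_mul_or_mul_eq_mul_of_mixture hp hq (hUVXY a x b true) (hUVXY a x b false)
    (hXVY x b true) (hXVY x b false) hmix).resolve_left hb
  have hUYX : (fun ω => U ω = a ∧ Y ω = y ∧ X ω = x) =
      fun ω => (U ω = a ∧ X ω = x) ∧ Y ω = y := by
    ext ω
    tauto
  have hYX : (fun ω => Y ω = y ∧ X ω = x) = fun ω => X ω = x ∧ Y ω = y := by
    ext ω
    tauto
  rw [hUYX, hYX, hUX, hX]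
  cases y
  · linear_combination -hrs
  · linear_combination hrs
end

section
/- Let F be a Boolean function on n variables whose multilinear extension, viewed as a multilinear polynomial f ∈ MvPolynomial (Fin n) ℝ, factorizes as f = g·h where g and h are both non-constant multilinear polynomials. Then there exist Boolean functions G and H on n variables and a nonzero real constant c such that F θ = G θ ∧ H θ for every assignment θ, the multilinear extension of G equals c·g, and the multilinear extension of H equals c⁻¹·h. -/
/-- The multilinear extension (arithmetization) of a Boolean function on `n`
variables, as a multivariate polynomial over `ℝ`. -/
noncomputable def mlpoly {n : ℕ} (F : (Fin n → Bool) → Bool) :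
    MvPolynomial (Fin n) ℝ :=
  ∑ θ : Fin n → Bool, (if F θ then (1 : MvPolynomial (Fin n) ℝ) else 0) *
    ∏ i : Fin n, (if θ i then MvPolynomial.X i else 1 - MvPolynomial.X i)

/-- The real point of the cube `{0, 1}ⁿ` corresponding to a Boolean assignment. -/
def cubePoint {n : ℕ} (θ : Fin n → Bool) : Fin n → ℝ :=
  fun i => if θ i then 1 else 0

theorem eval_cubePoint_mlpoly {n : ℕ} (F : (Fin n → Bool) → Bool) (θ : Fin n → Bool) :
    MvPolynomial.eval (cubePoint θ) (mlpoly F) = if F θ then 1 else 0 := by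
  unfold mlpoly
  rw [map_sum, Finset.sum_eq_single θ]
  · have hprod : ∏ i, MvPolynomial.eval (cubePoint θ)
        (if θ i then MvPolynomial.X i else 1 - MvPolynomial.X i) = 1 :=
      Finset.prod_eq_one fun i _ => by cases hi : θ i <;> simp [cubePoint, hi]
    rw [map_mul, map_prod, hprod]
    cases F θ <;> simp
  · intro η _ hη
    obtain ⟨i, hi⟩ := Function.ne_iff.mp hη
    rw [map_mul, map_prod, Finset.prod_eq_zero (Finset.mem_univ i), mul_zero]
    cases h₁ : η i <;> cases h₂ : θ i <;> simp_all [cubePoint]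
  · simp

theorem degreeOf_mlpoly_le_one {n : ℕ} (F : (Fin n → Bool) → Bool) (i : Fin n) :
    MvPolynomial.degreeOf i (mlpoly F) ≤ 1 := by
  unfold mlpoly
  refine (MvPolynomial.degreeOf_sum_le _ _ _).trans (Finset.sup_le fun θ _ => ?_)
  refine (MvPolynomial.degreeOf_mul_le _ _ _).trans ?_
  have hcoeff : MvPolynomial.degreeOf i
      (if F θ then (1 : MvPolynomial (Fin n) ℝ) else 0) = 0 := by
    split_ifs <;> simp
  rw [hcoeff, zero_add]
  refine (MvPolynomial.degreeOf_prod_le _ _ _).trans ?_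
  refine (Finset.sum_le_sum (g := fun j => if i = j then 1 else 0) fun j _ => ?_).trans (by simp)
  rw [← MvPolynomial.degreeOf_X (R := ℝ)]
  split_ifs
  · exact le_rfl
  · exact (MvPolynomial.degreeOf_sub_le _ _ _).trans (by simp)

/-- A multilinear polynomial is determined by its values on the Boolean cube. -/
theorem eq_of_eval_cubePoint_eq {n : ℕ} {p q : MvPolynomial (Fin n) ℝ}
    (hp : ∀ i, MvPolynomial.degreeOf i p ≤ 1) (hq : ∀ i, MvPolynomial.degreeOf i q ≤ 1)
    (h : ∀ θ, MvPolynomial.eval (cubePoint θ) p = MvPolynomial.eval (cubePoint θ) q) :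
    p = q := by
  refine sub_eq_zero.mp
    (MvPolynomial.eq_zero_of_eval_zero_at_prod_finset _ (fun _ => {0, 1}) (fun i => ?_)
      fun x hx => ?_)
  · rw [Finset.card_pair zero_ne_one]
    exact Nat.lt_succ_of_le ((MvPolynomial.degreeOf_sub_le _ _ _).trans (max_le (hp i) (hq i)))
  · have hx' : x = cubePoint fun i => decide (x i = 1) := by
      funext i
      have hi := hx i
      simp only [Finset.mem_insert, Finset.mem_singleton] at hi
      rcases hi with hi | hi <;> simp [cubePoint, hi]
    rw [hx', map_sub, h, sub_self]

theorem eval_cubePoint_congr {n : ℕ} {p : MvPolynomial (Fin n) ℝ} {θ η : Fin n → Bool}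
    (h : ∀ i ∈ p.vars, θ i = η i) :
    MvPolynomial.eval (cubePoint θ) p = MvPolynomial.eval (cubePoint η) p :=
  MvPolynomial.eval₂Hom_congr' rfl (fun i hi _ => by simp [cubePoint, h i hi]) rfl

theorem stmt_16 (n : ℕ) (F : (Fin n → Bool) → Bool)
    (g h : MvPolynomial (Fin n) ℝ)
    (hgml : ∀ i : Fin n, MvPolynomial.degreeOf i g ≤ 1)
    (hhml : ∀ i : Fin n, MvPolynomial.degreeOf i h ≤ 1)
    (hgnc : ∀ r : ℝ, g ≠ MvPolynomial.C r)
    (hhnc : ∀ r : ℝ, h ≠ MvPolynomial.C r)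
    (hfact : mlpoly F = g * h) :
    ∃ (G H : (Fin n → Bool) → Bool) (c : ℝ), c ≠ 0 ∧
      (∀ θ : Fin n → Bool, F θ = (G θ && H θ)) ∧
      mlpoly G = MvPolynomial.C c * g ∧
      mlpoly H = MvPolynomial.C c⁻¹ * h := by
  classical
  have hg0 : g ≠ 0 := by simpa using hgnc 0
  have hh0 : h ≠ 0 := by simpa using hhnc 0
  have hdisj : ∀ i ∈ h.vars, i ∉ g.vars := by
    intro i hi hi'
    rw [MvPolynomial.mem_vars_iff_degreeOf_ne_zero] at hi hi'
    have hdeg := degreeOf_mlpoly_le_one F i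
    rw [hfact, MvPolynomial.degreeOf_mul_eq hg0 hh0] at hdeg
    omega
  have heval : ∀ θ, MvPolynomial.eval (cubePoint θ) g * MvPolynomial.eval (cubePoint θ) h =
      if F θ then 1 else 0 := fun θ => by
    rw [← map_mul, ← hfact, eval_cubePoint_mlpoly]
  obtain ⟨η, hη⟩ : ∃ η, F η = true := by
    by_contra! hF
    refine mul_ne_zero hg0 hh0 ?_
    rw [← hfact]
    simp [mlpoly, hF]
  set a := MvPolynomial.eval (cubePoint η) g with ha
  set c := MvPolynomial.eval (cubePoint η) h with hc
  have hac : a * c = 1 := by simpa [hη] using heval η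
  have hc0 : c ≠ 0 := right_ne_zero_of_mul_eq_one hac
  have hainv : c⁻¹ = a := (eq_inv_of_mul_eq_one_left hac).symm
  let mix (θ ρ : Fin n → Bool) : Fin n → Bool := fun i => if i ∈ g.vars then θ i else ρ i
  have hmix : ∀ θ ρ, MvPolynomial.eval (cubePoint θ) g * MvPolynomial.eval (cubePoint ρ) h =
      if F (mix θ ρ) then 1 else 0 := fun θ ρ => by
    rw [← heval,
      eval_cubePoint_congr (p := g) (θ := mix θ ρ) (η := θ) fun i hi => by simp [mix, hi],
      eval_cubePoint_congr (p := h) (θ := mix θ ρ) (η := ρ) fun i hi => by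
        simp [mix, hdisj i hi]]
  refine ⟨fun θ => F (mix θ η), fun θ => F (mix η θ), c, hc0, fun θ => ?_,
    eq_of_eval_cubePoint_eq (degreeOf_mlpoly_le_one _)
      (fun i => (MvPolynomial.degreeOf_C_mul_le _ _ _).trans (hgml i)) fun θ => ?_,
    eq_of_eval_cubePoint_eq (degreeOf_mlpoly_le_one _)
      (fun i => (MvPolynomial.degreeOf_C_mul_le _ _ _).trans (hhml i)) fun θ => ?_⟩
  · have hprod : (if F θ then (1 : ℝ) else 0) =
        (if F (mix θ η) then 1 else 0) * (if F (mix η θ) then 1 else 0) := by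
      rw [← heval, ← hmix, ← hmix, ← ha, ← hc]
      linear_combination
        -(MvPolynomial.eval (cubePoint θ) g * MvPolynomial.eval (cubePoint θ) h) * hac
    cases h₁ : F θ <;> cases h₂ : F (mix θ η) <;> cases h₃ : F (mix η θ) <;> simp_all
  · rw [eval_cubePoint_mlpoly, ← hmix, map_mul, MvPolynomial.eval_C, mul_comm]
  · rw [eval_cubePoint_mlpoly, ← hmix, map_mul, MvPolynomial.eval_C, hainv]
end

section
/- Let p be a real polynomial in two groups of n variables, p(x₁,…,x_n, y₁,…,y_n). Let v = (v₁,…,v_n) be a vector of strictly positive reals such that p(v, 1) ≠ 0 (where 1 denotes the all-ones vector), and let w = (w₁,…,w_n) be any other vector of strictly positive reals. Then there exists a finite set Γ of pairs of real numbers (α, β), each with (α, β) ≠ (0, 0), such that: for all natural numbers s, t ≥ 1 satisfying s·α + t·β ≠ 0 for every (α, β) ∈ Γ, there exists k₀ such that for all k ≥ k₀, p(v₁^{ks}, …, v_n^{ks}, w₁^{kt}, …, w_n^{kt}) ≠ 0. -/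
/-- A nontrivial real linear combination of exponentials with distinct rates is eventually
nonzero. -/
theorem eventually_sum_mul_exp_ne_zero {ι : Type*} (T : Finset ι) (hT : T.Nonempty)
    (c r : ι → ℝ) (hc : ∀ q ∈ T, c q ≠ 0) (hr : Set.InjOn r T) :
    ∀ᶠ k : ℕ in Filter.atTop, ∑ q ∈ T, c q * Real.exp (k * r q) ≠ 0 := by
  classical
  obtain ⟨q₀, hq₀, hmax⟩ := T.exists_max_image r hT
  have hlim : Filter.Tendsto (fun k : ℕ => ∑ q ∈ T, c q * Real.exp (k * (r q - r q₀)))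
      Filter.atTop (nhds (∑ q ∈ T, if q = q₀ then c q₀ else 0)) := by
    refine tendsto_finsetSum T fun q hq => ?_
    by_cases h : q = q₀
    · simp [h]
    · have hlt : r q - r q₀ < 0 :=
        sub_neg.2 (lt_of_le_of_ne (hmax q hq) fun e => h (hr hq hq₀ e))
      have hexp : Filter.Tendsto (fun k : ℕ => Real.exp (k * (r q - r q₀)))
          Filter.atTop (nhds 0) :=
        Real.tendsto_exp_atBot.comp
          (tendsto_natCast_atTop_atTop.atTop_mul_const_of_neg hlt)
      simpa [h] using hexp.const_mul (c q)
  rw [Finset.sum_ite_eq' T q₀, if_pos hq₀] at hlim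
  filter_upwards [hlim.eventually_ne (hc q₀ hq₀)] with k hk hzero
  apply hk
  have : ∑ q ∈ T, c q * Real.exp (k * (r q - r q₀)) =
      (∑ q ∈ T, c q * Real.exp (k * r q)) * Real.exp (-(k * r q₀)) := by
    rw [Finset.sum_mul]
    refine Finset.sum_congr rfl fun q _ => ?_
    rw [mul_assoc, ← Real.exp_add]
    ring_nf
  rw [this, hzero, zero_mul]

/-- Along the two-parameter families `x ↦ exp (x * a i)` and `y ↦ exp (y * b j)`, a polynomial is
a combination of exponentials of linear forms in `x` and `y`, with nonzero coefficients. -/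
theorem MvPolynomial.exists_eval_exp_eq_sum {σ τ : Type*} [Fintype σ] [Fintype τ]
    (p : MvPolynomial (σ ⊕ τ) ℝ) (a : σ → ℝ) (b : τ → ℝ) :
    ∃ (T : Finset (ℝ × ℝ)) (c : ℝ × ℝ → ℝ), (∀ q ∈ T, c q ≠ 0) ∧
      ∀ x y : ℝ, MvPolynomial.eval
        (Sum.elim (fun i => Real.exp (x * a i)) (fun j => Real.exp (y * b j))) p =
          ∑ q ∈ T, c q * Real.exp (x * q.1 + y * q.2) := by
  classical
  let g : (σ ⊕ τ →₀ ℕ) → ℝ × ℝ := fun m =>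
    (∑ i, m (Sum.inl i) * a i, ∑ j, m (Sum.inr j) * b j)
  let c : ℝ × ℝ → ℝ := fun q => ∑ m ∈ p.support with g m = q, p.coeff m
  refine ⟨(p.support.image g).filter (c · ≠ 0), c, fun q hq => (Finset.mem_filter.1 hq).2,
    fun x y => ?_⟩
  rw [Finset.sum_filter_of_ne fun q _ h => left_ne_zero_of_mul h, MvPolynomial.eval_eq',
    ← Finset.sum_fiberwise_of_maps_to fun m hm => Finset.mem_image_of_mem g hm]
  refine Finset.sum_congr rfl fun q _ => ?_
  rw [Finset.sum_mul]
  refine Finset.sum_congr rfl fun m hm => ?_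
  rw [← (Finset.mem_filter.1 hm).2, Fintype.prod_sum_type, Real.exp_add]
  simp only [g, Sum.elim_inl, Sum.elim_inr, Finset.mul_sum, Real.exp_sum, ← Real.exp_nat_mul,
    mul_left_comm]

theorem stmt_17 (n : ℕ) (p : MvPolynomial (Fin n ⊕ Fin n) ℝ)
    (v w : Fin n → ℝ) (hv : ∀ i, 0 < v i) (hw : ∀ i, 0 < w i)
    (hp : MvPolynomial.eval (Sum.elim v (fun _ => (1 : ℝ))) p ≠ 0) :
    ∃ Γ : Finset (ℝ × ℝ), (∀ ab ∈ Γ, ab ≠ (0, 0)) ∧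
      ∀ s t : ℕ, 1 ≤ s → 1 ≤ t →
        (∀ ab ∈ Γ, (s : ℝ) * ab.1 + (t : ℝ) * ab.2 ≠ 0) →
        ∃ k₀ : ℕ, ∀ k ≥ k₀,
          MvPolynomial.eval
            (Sum.elim (fun i => v i ^ (k * s)) (fun i => w i ^ (k * t))) p ≠ 0 := by
  classical
  obtain ⟨T, c, hc, heval⟩ := MvPolynomial.exists_eval_exp_eq_sum p
    (fun i => Real.log (v i)) (fun i => Real.log (w i))
  have hT : T.Nonempty := by
    rw [Finset.nonempty_iff_ne_empty]
    rintro rfl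
    apply hp
    simpa [Real.exp_log (hv _)] using heval 1 0
  refine ⟨T.offDiag.image fun q => q.1 - q.2, ?_, fun s t _ _ hΓ => ?_⟩
  · simp only [Finset.mem_image, Finset.mem_offDiag]
    rintro _ ⟨q, ⟨_, _, hne⟩, rfl⟩
    exact sub_ne_zero.2 hne
  · have hinj : Set.InjOn (fun q : ℝ × ℝ => (s : ℝ) * q.1 + t * q.2) T := by
      intro q hq q' hq' h
      by_contra hne
      refine hΓ (q - q') (Finset.mem_image.2
        ⟨(q, q'), Finset.mem_offDiag.2 ⟨hq, hq', hne⟩, rfl⟩) ?_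
      simp only [Prod.fst_sub, Prod.snd_sub] at h ⊢
      linarith
    obtain ⟨k₀, hk₀⟩ := Filter.eventually_atTop.1
      (eventually_sum_mul_exp_ne_zero T hT c _ hc hinj)
    refine ⟨k₀, fun k hk => ?_⟩
    have hpow : ∀ u : ℝ, 0 < u → ∀ e : ℕ,
        u ^ (k * e) = Real.exp (((k : ℝ) * e) * Real.log u) := fun u hu e => by
      rw [← Nat.cast_mul, Real.exp_nat_mul, Real.exp_log hu]
    simp only [hpow _ (hv _), hpow _ (hw _), heval]
    simpa only [mul_add, mul_assoc] using hk₀ k hk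
end

section
/- Let f₁, …, f_m be multivariate real polynomials in n variables. Suppose that for each i ∈ {1, …, m} there exists a vector vᵢ = (v_{i1}, …, v_{in}) of strictly positive real numbers such that fᵢ(vᵢ) ≠ 0. Then there exist natural numbers k₁, …, k_m ≥ 1 such that, setting u_j = ∏_{i=1}^{m} (v_{ij})^{kᵢ} for each j (the componentwise product of the powers vᵢ^{kᵢ}), one has fᵢ(u) ≠ 0 for every i ∈ {1, …, m}. -/
open Filter Topology in
/-- A real exponential sum with positive bases vanishes either identically on `ℕ` or only finitely
often. -/
theorem eventually_sum_mul_pow_ne_zero (T : Finset ℝ) (a : ℝ → ℝ) (hT : ∀ b ∈ T, 0 < b)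
    (h : ∃ t : ℕ, ∑ b ∈ T, a b * b ^ t ≠ 0) :
    ∀ᶠ t : ℕ in atTop, ∑ b ∈ T, a b * b ^ t ≠ 0 := by
  induction T using Finset.induction_on_max with
  | empty => simp at h
  | insert M T hM ih =>
    have hMT : M ∉ T := fun hmem => lt_irrefl M (hM M hmem)
    simp only [Finset.sum_insert hMT] at h ⊢
    by_cases haM : a M = 0
    · simp only [haM, zero_mul, zero_add] at h ⊢
      exact ih (fun b hb => hT b (Finset.mem_insert_of_mem hb)) h
    · have hM0 : 0 < M := hT M (Finset.mem_insert_self M T)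
      have hlim : Tendsto (fun t : ℕ => a M + ∑ b ∈ T, a b * (b / M) ^ t) atTop
          (𝓝 (a M + ∑ b ∈ T, a b * 0)) := by
        refine tendsto_const_nhds.add (tendsto_finsetSum _ fun b hb => ?_)
        have hb0 : 0 < b := hT b (Finset.mem_insert_of_mem hb)
        exact (tendsto_pow_atTop_nhds_zero_of_lt_one (by positivity)
          ((div_lt_one hM0).2 (hM b hb))).const_mul (a b)
      filter_upwards [hlim.eventually_ne (by simpa using haM)] with t ht hzero
      have hMt : M ^ t ≠ 0 := (pow_pos hM0 t).ne'
      refine ht (mul_right_cancel₀ hMt ?_)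
      rw [zero_mul, ← hzero, add_mul, Finset.sum_mul]
      congr 1
      refine Finset.sum_congr rfl fun b _ => ?_
      rw [div_pow, mul_assoc, div_mul_cancel₀ _ hMt]

open Filter in
/-- Along a geometric progression with positive ratio, a polynomial that does not vanish at every
term vanishes only finitely often. -/
theorem MvPolynomial.eventually_eval_mul_pow_ne_zero {σ : Type*} [Fintype σ]
    (f : MvPolynomial σ ℝ) (x v : σ → ℝ) (hv : ∀ j, 0 < v j) (t₀ : ℕ)
    (h : MvPolynomial.eval (x * v ^ t₀) f ≠ 0) :
    ∀ᶠ t : ℕ in atTop, MvPolynomial.eval (x * v ^ t) f ≠ 0 := by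
  classical
  let base : (σ →₀ ℕ) → ℝ := fun d => ∏ j, v j ^ d j
  let c : (σ →₀ ℕ) → ℝ := fun d => f.coeff d * ∏ j, x j ^ d j
  have key : ∀ t : ℕ, MvPolynomial.eval (x * v ^ t) f =
      ∑ b ∈ f.support.image base, (∑ d ∈ f.support with base d = b, c d) * b ^ t := by
    intro t
    rw [MvPolynomial.eval_eq', ← Finset.sum_fiberwise_of_maps_to
      (fun d hd => Finset.mem_image_of_mem base hd)]
    refine Finset.sum_congr rfl fun b _ => ?_
    rw [Finset.sum_mul]
    refine Finset.sum_congr rfl fun d hd => ?_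
    rw [← (Finset.mem_filter.1 hd).2]
    simp only [c, base, Pi.mul_apply, Pi.pow_apply, mul_pow, Finset.prod_mul_distrib,
      ← Finset.prod_pow, mul_assoc, ← pow_mul, mul_comm t]
  simp only [key] at h ⊢
  refine eventually_sum_mul_pow_ne_zero _
    (fun b => ∑ d ∈ f.support with base d = b, c d) (fun b hb => ?_) ⟨t₀, h⟩
  obtain ⟨d, -, rfl⟩ := Finset.mem_image.1 hb
  exact Finset.prod_pos fun j _ => pow_pos (hv j) _

open Filter in
/-- Polynomials that are nonzero at respective positive points are simultaneously nonzero at some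
product of positive powers of these points. -/
theorem MvPolynomial.exists_eval_prod_pow_ne_zero {ι σ : Type*} [Fintype σ]
    (f : ι → MvPolynomial σ ℝ) (v : ι → σ → ℝ) (hv : ∀ i j, 0 < v i j)
    (hf : ∀ i, MvPolynomial.eval (v i) (f i) ≠ 0) (S : Finset ι) :
    ∃ k : ι → ℕ, (∀ i, 1 ≤ k i) ∧
      ∀ i ∈ S, MvPolynomial.eval (∏ l ∈ S, v l ^ k l) (f i) ≠ 0 := by
  classical
  induction S using Finset.induction_on with
  | empty => exact ⟨fun _ => 1, by simp⟩
  | insert a S ha ih =>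
    obtain ⟨k, hk, hS⟩ := ih
    set w : σ → ℝ := ∏ l ∈ S, v l ^ k l with hw_def
    have hw : ∀ j, 0 < w j := fun j => by
      simp only [hw_def, Finset.prod_apply, Pi.pow_apply]
      exact Finset.prod_pos fun l _ => pow_pos (hv l j) _
    have hsS : ∀ᶠ s : ℕ in atTop, ∀ i ∈ S, MvPolynomial.eval (1 * w ^ s) (f i) ≠ 0 :=
      (Finset.eventually_all S).2 fun i hi =>
        (f i).eventually_eval_mul_pow_ne_zero 1 w hw 1 (by simpa using hS i hi)
    have hsa : ∀ᶠ s : ℕ in atTop, MvPolynomial.eval (v a * w ^ s) (f a) ≠ 0 :=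
      (f a).eventually_eval_mul_pow_ne_zero (v a) w hw 0 (by simpa using hf a)
    obtain ⟨s, hsS, hsa, hs⟩ := (hsS.and (hsa.and (eventually_ge_atTop 1))).exists
    have htS : ∀ᶠ t : ℕ in atTop, ∀ i ∈ S, MvPolynomial.eval (w ^ s * v a ^ t) (f i) ≠ 0 :=
      (Finset.eventually_all S).2 fun i hi =>
        (f i).eventually_eval_mul_pow_ne_zero (w ^ s) (v a) (hv a) 0 (by simpa using hsS i hi)
    have hta : ∀ᶠ t : ℕ in atTop, MvPolynomial.eval (w ^ s * v a ^ t) (f a) ≠ 0 :=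
      (f a).eventually_eval_mul_pow_ne_zero (w ^ s) (v a) (hv a) 1
        (by simpa [mul_comm] using hsa)
    obtain ⟨t, htS, hta, ht⟩ := (htS.and (hta.and (eventually_ge_atTop 1))).exists
    refine ⟨fun l => if l = a then t else k l * s, fun i => ?_, ?_⟩
    · dsimp only
      split_ifs
      exacts [ht, Nat.mul_pos (hk i) hs]
    · have hprod : ∏ l ∈ insert a S, v l ^ (if l = a then t else k l * s) = w ^ s * v a ^ t := by
        rw [Finset.prod_insert ha, if_pos rfl, mul_comm, hw_def, ← Finset.prod_pow]
        congr 1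
        refine Finset.prod_congr rfl fun l hl => ?_
        rw [if_neg (ne_of_mem_of_not_mem hl ha), pow_mul]
      rw [hprod]
      exact Finset.forall_mem_insert _ _ _ |>.2 ⟨hta, htS⟩

theorem stmt_18 (n m : ℕ) (f : Fin m → MvPolynomial (Fin n) ℝ)
    (v : Fin m → Fin n → ℝ) (hv : ∀ i j, 0 < v i j)
    (hf : ∀ i, MvPolynomial.eval (v i) (f i) ≠ 0) :
    ∃ k : Fin m → ℕ, (∀ i, 1 ≤ k i) ∧
      ∀ i, MvPolynomial.eval (fun j => ∏ i' : Fin m, (v i' j) ^ (k i')) (f i) ≠ 0 := by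
  obtain ⟨k, hk, h⟩ := MvPolynomial.exists_eval_prod_pow_ne_zero f v hv hf Finset.univ
  refine ⟨k, hk, fun i => ?_⟩
  have hprod : (fun j => ∏ l, v l j ^ k l) = ∏ l, v l ^ k l := by
    ext j
    simp
  rw [hprod]
  exact h i (Finset.mem_univ i)
end

section
/- Let p be a multivariate real polynomial in n variables and let v = (v₁, …, v_n) be a vector of strictly positive real numbers with p(v) ≠ 0. Then there exists k₀ ∈ ℕ such that for every k ≥ k₀, p(v₁^k, …, v_n^k) ≠ 0; that is, p does not vanish at all sufficiently large componentwise powers of v. -/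
open Filter Topology in
/-- An exponential sum with distinct positive bases and some nonzero coefficient is eventually
nonzero. -/
theorem eventually_sum_mul_pow_ne_zero_s19 {s : Finset ℝ} (hs : ∀ x ∈ s, 0 < x) {c : ℝ → ℝ}
    (hc : ∃ x ∈ s, c x ≠ 0) : ∀ᶠ k : ℕ in atTop, ∑ x ∈ s, c x * x ^ k ≠ 0 := by
  obtain ⟨y, hys, hy⟩ := hc
  obtain ⟨M, hM, hmax⟩ := (s.filter (c · ≠ 0)).exists_max_image id
    ⟨y, Finset.mem_filter.2 ⟨hys, hy⟩⟩
  obtain ⟨hMs, hcM⟩ := Finset.mem_filter.1 hM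
  have hM0 := hs M hMs
  have hlim : Tendsto (fun k : ℕ => ∑ x ∈ s, c x * (x / M) ^ k) atTop
      (𝓝 (∑ x ∈ s, if x = M then c x else 0)) := by
    refine tendsto_finsetSum _ fun x hx => ?_
    split_ifs with hxM
    · simp [hxM, hM0.ne']
    · by_cases hcx : c x = 0
      · simp [hcx]
      · have hlt : x < M := lt_of_le_of_ne (hmax x (Finset.mem_filter.2 ⟨hx, hcx⟩)) hxM
        simpa using (tendsto_pow_atTop_nhds_zero_of_lt_one (div_pos (hs x hx) hM0).le
          ((div_lt_one hM0).2 hlt)).const_mul (c x)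
  rw [Finset.sum_ite_eq' s M c, if_pos hMs] at hlim
  filter_upwards [hlim.eventually_ne hcM] with k hk h0
  apply hk
  simp_rw [div_pow, ← mul_div_assoc, ← Finset.sum_div, h0, zero_div]

/-- Evaluation at the `k`-th power of a point, with monomials grouped by their value there. -/
theorem MvPolynomial.eval_pow_eq_sum_image {σ : Type*} (p : MvPolynomial σ ℝ) (v : σ → ℝ)
    (k : ℕ) :
    eval (fun j => v j ^ k) p = ∑ x ∈ p.support.image fun d => d.prod fun j e => v j ^ e,
      (∑ d ∈ p.support with (d.prod fun j e => v j ^ e) = x, p.coeff d) * x ^ k := by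
  rw [eval_eq]
  refine (Finset.sum_fiberwise_of_maps_to
    (fun d hd => Finset.mem_image_of_mem (fun d => d.prod fun j e => v j ^ e) hd) _).symm.trans
      (Finset.sum_congr rfl fun x _ => ?_)
  rw [Finset.sum_mul]
  refine Finset.sum_congr rfl fun d hd => ?_
  rw [← (Finset.mem_filter.1 hd).2, Finsupp.prod, ← Finset.prod_pow]
  simp_rw [← pow_mul, mul_comm k]

theorem stmt_19 (n : ℕ) (p : MvPolynomial (Fin n) ℝ) (v : Fin n → ℝ)
    (hv : ∀ j, 0 < v j) (hp : MvPolynomial.eval v p ≠ 0) :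
    ∃ k₀ : ℕ, ∀ k ≥ k₀, MvPolynomial.eval (fun j => v j ^ k) p ≠ 0 := by
  rw [← Filter.eventually_atTop]
  simp_rw [MvPolynomial.eval_pow_eq_sum_image]
  refine eventually_sum_mul_pow_ne_zero_s19 (fun x hx => ?_) ?_
  · obtain ⟨d, -, rfl⟩ := Finset.mem_image.1 hx
    exact Finset.prod_pos fun j _ => pow_pos (hv j) _
  · have h1 := MvPolynomial.eval_pow_eq_sum_image p v 1
    simp only [pow_one] at h1
    rw [h1] at hp
    obtain ⟨x, hx, hne⟩ := Finset.exists_ne_zero_of_sum_ne_zero hp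
    exact ⟨x, hx, left_ne_zero_of_mul hne⟩
end
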